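/- Let a > 0 and D₁, C₁, C₃, ξ₁, ξ₂, ξ₃ ∈ ℝ. The function Y(r) = D₁·ξ₁·I₀(√a·r) − (D₁·I₁(√a·r)/(√a·r))·(2ξ₁ − ξ₂) + C₁·ξ₃/2 + C₃/r² is differentiable on (0,∞) and satisfies the ordinary differential equation Y'(r) + 2·Y(r)/r = D₁·ξ₁·√a·I₁(√a·r) + D₁·ξ₂·I₀(√a·r)/r + C₁·ξ₃/r for every r > 0. -/

import Mathlib

open Real Filter Set

/-- Modified Bessel function of the first kind of order zero:
`I₀(x) = ∑ x^(2n) / (4^n (n!)²)`. -/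
noncomputable def I0 (x : ℝ) : ℝ :=
  ∑' n : ℕ, x ^ (2 * n) / ((4 : ℝ) ^ n * ((n.factorial : ℝ)) ^ 2)

/-- Modified Bessel function of the first kind of order one:
`I₁(x) = ∑ x^(2n+1) / (2^(2n+1) n! (n+1)!)`. -/
noncomputable def I1 (x : ℝ) : ℝ :=
  ∑' n : ℕ, x ^ (2 * n + 1) /
    ((2 : ℝ) ^ (2 * n + 1) * (n.factorial : ℝ) * (((n + 1).factorial : ℝ)))

theorem summable_I0_terms (x : ℝ) :
    Summable fun n : ℕ => x ^ (2 * n) / ((4 : ℝ) ^ n * ((n.factorial : ℝ)) ^ 2) := by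
  refine Summable.of_nonneg_of_le (fun n => ?_) (fun n => ?_)
    (Real.summable_pow_div_factorial (x ^ 2 / 4))
  · rw [pow_mul]
    positivity
  · have h1 : (1 : ℝ) ≤ n.factorial := by exact_mod_cast n.factorial_pos
    rw [pow_mul, div_pow, div_div]
    gcongr
    exact le_self_pow₀ h1 two_ne_zero

theorem summable_I1_terms (x : ℝ) :
    Summable fun n : ℕ => x ^ (2 * n + 1) /
      ((2 : ℝ) ^ (2 * n + 1) * (n.factorial : ℝ) * (((n + 1).factorial : ℝ))) := by
  refine Summable.of_norm_bounded ((summable_I0_terms x).mul_left |x|) fun n => ?_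
  have h1 : (n.factorial : ℝ) ≤ (n + 1).factorial := by
    exact_mod_cast Nat.factorial_le n.le_succ
  have h2 : (4 : ℝ) ^ n ≤ 2 ^ (2 * n + 1) := by
    rw [pow_succ, pow_mul]
    norm_num
  rw [norm_div, norm_pow, Real.norm_eq_abs, Real.norm_of_nonneg (by positivity), pow_succ',
    mul_div_assoc, pow_mul, sq_abs, ← pow_mul, sq, ← mul_assoc]
  have h3 : 0 ≤ x ^ (2 * n) := by
    rw [pow_mul]
    positivity
  gcongr

theorem hasDerivAt_I0 (x : ℝ) : HasDerivAt I0 (I1 x) x := by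
  have hI0 : I0 = fun y => 1 + ∑' n : ℕ, y ^ (2 * (n + 1)) /
      ((4 : ℝ) ^ (n + 1) * (((n + 1).factorial : ℝ)) ^ 2) := by
    funext y
    rw [I0, (summable_I0_terms y).tsum_eq_zero_add]
    simp
  rw [hI0]
  refine HasDerivAt.const_add _ ?_
  have hx : x ∈ Metric.ball (0 : ℝ) (|x| + 1) := by simp
  refine hasDerivAt_tsum_of_isPreconnected (t := Metric.ball (0 : ℝ) (|x| + 1)) (y₀ := x)
    (g' := fun n y => y ^ (2 * n + 1) /
      ((2 : ℝ) ^ (2 * n + 1) * (n.factorial : ℝ) * (((n + 1).factorial : ℝ))))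
    (summable_I1_terms (|x| + 1)) Metric.isOpen_ball
    (convex_ball (0 : ℝ) _).isPreconnected (fun n y _ => ?_) (fun n y hy => ?_) hx ?_ hx
  · convert! (hasDerivAt_pow (2 * (n + 1)) y).div_const _ using 1
    have h : (4 : ℝ) ^ n = 2 ^ (2 * n) := by
      rw [pow_mul]
      norm_num
    rw [show 2 * (n + 1) - 1 = 2 * n + 1 by omega, Nat.factorial_succ, pow_succ 4, h]
    push_cast
    field_simp
    ring
  · rw [norm_div, norm_pow, Real.norm_of_nonneg (by positivity :
      (0 : ℝ) ≤ 2 ^ (2 * n + 1) * (n.factorial : ℝ) * ((n + 1).factorial : ℝ))]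
    have h := (mem_ball_zero_iff.1 hy).le
    exact div_le_div_of_nonneg_right (pow_le_pow_left₀ (norm_nonneg y) h _) (by positivity)
  · exact (summable_nat_add_iff 1).2 (summable_I0_terms x)

theorem hasDerivAt_mul_I1 (x : ℝ) : HasDerivAt (fun y => y * I1 y) (x * I0 x) x := by
  simp only [I1, I0, ← tsum_mul_left]
  have hx : x ∈ Metric.ball (0 : ℝ) (|x| + 1) := by simp
  refine hasDerivAt_tsum_of_isPreconnected (t := Metric.ball (0 : ℝ) (|x| + 1)) (y₀ := x)
    (g' := fun n y => y * (y ^ (2 * n) / ((4 : ℝ) ^ n * ((n.factorial : ℝ)) ^ 2)))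
    ((summable_I0_terms (|x| + 1)).mul_left (|x| + 1)) Metric.isOpen_ball
    (convex_ball (0 : ℝ) _).isPreconnected (fun n y _ => ?_) (fun n y hy => ?_) hx ?_ hx
  · convert! (hasDerivAt_id y).mul ((hasDerivAt_pow (2 * n + 1) y).div_const _) using 1
    have h : (4 : ℝ) ^ n = 2 ^ (2 * n) := by
      rw [pow_mul]
      norm_num
    rw [show 2 * n + 1 - 1 = 2 * n by omega, Nat.factorial_succ, h]
    push_cast
    simp only [id]
    field_simp
    ring
  · rw [norm_mul, norm_div, norm_pow, Real.norm_of_nonneg (by positivity :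
      (0 : ℝ) ≤ 4 ^ n * (n.factorial : ℝ) ^ 2)]
    have h := (mem_ball_zero_iff.1 hy).le
    exact mul_le_mul h
      (div_le_div_of_nonneg_right (pow_le_pow_left₀ (norm_nonneg y) h _) (by positivity))
      (by positivity) (by positivity)
  · exact (summable_I1_terms x).mul_left x

theorem hasDerivAt_I1_div {x : ℝ} (hx : x ≠ 0) :
    HasDerivAt (fun y => I1 y / y) (I0 x / x - 2 * I1 x / x ^ 2) x := by
  have h := (hasDerivAt_mul_I1 x).div (hasDerivAt_pow 2 x) (pow_ne_zero 2 hx)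
  refine (h.congr_deriv ?_).congr_of_eventuallyEq ?_
  · push_cast
    field_simp
  · filter_upwards [isOpen_ne.mem_nhds hx] with y hy
    have hy : y ≠ 0 := hy
    simp only [Pi.div_apply]
    field_simp

/-- for `a > 0`, the function
`Y(r) = D₁·ξ₁·I₀(√a·r) − (D₁·I₁(√a·r)/(√a·r))·(2ξ₁ − ξ₂) + C₁·ξ₃/2 + C₃/r²`
is differentiable on `(0,∞)` and satisfies
`Y'(r) + 2·Y(r)/r = D₁·ξ₁·√a·I₁(√a·r) + D₁·ξ₂·I₀(√a·r)/r + C₁·ξ₃/r` there. -/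
theorem Y_solves_ODE (a D₁ C₁ C₃ ξ₁ ξ₂ ξ₃ : ℝ) (ha : 0 < a) :
    let Y : ℝ → ℝ := fun r =>
      D₁ * ξ₁ * I0 (Real.sqrt a * r) -
        D₁ * I1 (Real.sqrt a * r) / (Real.sqrt a * r) * (2 * ξ₁ - ξ₂) +
        C₁ * ξ₃ / 2 + C₃ / r ^ 2
    ∀ r : ℝ, 0 < r →
      DifferentiableAt ℝ Y r ∧
      deriv Y r + 2 * Y r / r =
        D₁ * ξ₁ * Real.sqrt a * I1 (Real.sqrt a * r) +
          D₁ * ξ₂ * (I0 (Real.sqrt a * r) / r) + C₁ * ξ₃ / r := by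
  intro Y r hr
  have hs : 0 < Real.sqrt a := Real.sqrt_pos.2 ha
  have hx : Real.sqrt a * r ≠ 0 := (mul_pos hs hr).ne'
  have hlin : HasDerivAt (fun r => Real.sqrt a * r) (Real.sqrt a) r := by
    simpa using (hasDerivAt_id r).const_mul (Real.sqrt a)
  have h0 := ((hasDerivAt_I0 _).comp r hlin).const_mul (D₁ * ξ₁)
  have h1 := (((hasDerivAt_I1_div hx).comp r hlin).const_mul D₁).mul_const (2 * ξ₁ - ξ₂)
  have h2 := (hasDerivAt_const r C₃).div (hasDerivAt_pow 2 r) (pow_ne_zero 2 hr.ne')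
  have hY : HasDerivAt Y _ r :=
    (((h0.sub h1).add_const (C₁ * ξ₃ / 2)).add h2).congr_of_eventuallyEq
      (Eventually.of_forall fun y => by simp [Y, mul_div_assoc])
  refine ⟨hY.differentiableAt, ?_⟩
  rw [hY.deriv]
  simp only [Y]
  push_cast
  field_simp
  ring
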